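/- There is a universal constant α > 0 such that the following holds. Let G = (X, Y, Q, Σ_X, Σ_Y, P) be a two-prover game in which Q is the uniform distribution over a set E ⊆ X × Y, let d_max be the maximum degree of a vertex in the bipartite graph (X, Y, E), let c = log(|Σ_X||Σ_Y|) (natural logarithm), and suppose val(G) = 1 − ε. Then for all integers 0 ≤ k ≤ |X| and 0 ≤ l ≤ |Y|, val(G^{k×l}) ≤ 2·(1 − ε/2)^{α·ε^5·k·l·|E| / (d_max·|X|·|Y|·c^2)}. -/

import Mathlib

open Finset

attribute [local instance] Classical.propDecidable

noncomputable section

/-- The value of a two-prover game with question sets `QX`, `QY`, answer sets `AX`, `AY`,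
question distribution `Q` and verification predicate `P`. -/
def gameVal {QX QY AX AY : Type*} [Fintype QX] [Fintype QY] [Fintype AX] [Fintype AY]
    [Nonempty AX] [Nonempty AY] (Q : QX → QY → ℝ) (P : QX → QY → AX → AY → Prop) : ℝ :=
  (Finset.univ : Finset ((QX → AX) × (QY → AY))).sup'
    ⟨(fun _ => Classical.arbitrary AX, fun _ => Classical.arbitrary AY), Finset.mem_univ _⟩
    fun φ => ∑ x : QX, ∑ y : QY, Q x y * (if P x y (φ.1 x) (φ.2 y) then 1 else 0)

/-- The uniform distribution over a finite set `E` of question pairs. -/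
def unifOn {QX QY : Type*} (E : Finset (QX × QY)) : QX → QY → ℝ :=
  fun x y => if (x, y) ∈ E then (E.card : ℝ)⁻¹ else 0

/-- Maximum degree of a vertex in the bipartite graph `(X, Y, E)`. -/
def maxDeg {X Y : Type*} [Fintype X] [Fintype Y] (E : Finset (X × Y)) : ℕ :=
  max (Finset.univ.sup fun x : X => (E.filter fun e => e.1 = x).card)
      (Finset.univ.sup fun y : Y => (E.filter fun e => e.2 = y).card)

/-- The predicate of a birthday-repetition game: all edges between `S` and `T` must be
answered acceptably. -/
def bPred {X Y AX AY : Type*} (E : Finset (X × Y)) (P : X → Y → AX → AY → Prop) :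
    Finset X → Finset Y → (X → AX) → (Y → AY) → Prop :=
  fun S T a b => ∀ x ∈ S, ∀ y ∈ T, (x, y) ∈ E → P x y (a x) (b y)

/-- Value of the `(k × l)`-birthday repetition `G^{k×l}`: questions are uniformly random
`k`-subsets of `X` and `l`-subsets of `Y`. -/
def birthdayVal {X Y AX AY : Type*} [Fintype X] [Fintype Y] [Fintype AX] [Fintype AY]
    [Nonempty AX] [Nonempty AY] (E : Finset (X × Y)) (P : X → Y → AX → AY → Prop)
    (k l : ℕ) : ℝ :=
  gameVal
    (fun (S : Finset X) (T : Finset Y) =>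
      if S.card = k ∧ T.card = l then
        (((Fintype.card X).choose k : ℝ) * ((Fintype.card Y).choose l : ℝ))⁻¹
      else 0)
    (bPred E P)

/-- Value of the `r`-fold parallel repetition `G^{⊗r}`. -/
def parVal {X Y AX AY : Type*} [Fintype X] [Fintype Y] [Fintype AX] [Fintype AY]
    [Nonempty AX] [Nonempty AY] (Q : X → Y → ℝ) (P : X → Y → AX → AY → Prop) (r : ℕ) : ℝ :=
  gameVal (fun (xs : Fin r → X) (ys : Fin r → Y) => ∏ i, Q (xs i) (ys i))
    (fun xs ys (a : Fin r → AX) (b : Fin r → AY) => ∀ i, P (xs i) (ys i) (a i) (b i))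

/-- `E^r_set` : tuples of `r` edges of `E` whose endpoints are all distinct. -/
def ErSet {X Y : Type*} [Fintype X] [Fintype Y] (E : Finset (X × Y)) (r : ℕ) :
    Finset ((Fin r → X) × (Fin r → Y)) :=
  Finset.univ.filter fun p =>
    (∀ i, (p.1 i, p.2 i) ∈ E) ∧ Function.Injective p.1 ∧ Function.Injective p.2

/-- Value of `G^{⊗r}_set are`, the parallel repetition with question distribution uniform
over `E^r_set`. -/
def parSetVal {X Y AX AY : Type*} [Fintype X] [Fintype Y] [Fintype AX] [Fintype AY]
    [Nonempty AX] [Nonempty AY] (E : Finset (X × Y)) (P : X → Y → AX → AY → Prop)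
    (r : ℕ) : ℝ :=
  gameVal (fun xs ys => if (xs, ys) ∈ ErSet E r then ((ErSet E r).card : ℝ)⁻¹ else 0)
    (fun xs ys (a : Fin r → AX) (b : Fin r → AY) => ∀ i, P (xs i) (ys i) (a i) (b i))

/-- The distribution `Q^{k×l}_em`: sample a tuple of `r` disjoint edges uniformly from
`E^r_set`, then complete the endpoints to a uniformly random `k`-subset of `X` and
`l`-subset of `Y`. -/
def Qem {X Y : Type*} [Fintype X] [Fintype Y] (E : Finset (X × Y)) (r k l : ℕ) :
    Finset X → Finset Y → ℝ :=
  fun S T =>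
    ((ErSet E r).card : ℝ)⁻¹ *
      ∑ p ∈ ErSet E r,
        (if S.card = k ∧ T.card = l ∧ (∀ i, p.1 i ∈ S) ∧ (∀ i, p.2 i ∈ T) then
            (((Fintype.card X - r).choose (k - r) : ℝ) *
              ((Fintype.card Y - r).choose (l - r) : ℝ))⁻¹
          else 0)

/-- Value of `G^{k×l}_em`. -/
def birthdayEmVal {X Y AX AY : Type*} [Fintype X] [Fintype Y] [Fintype AX] [Fintype AY]
    [Nonempty AX] [Nonempty AY] (E : Finset (X × Y)) (P : X → Y → AX → AY → Prop)
    (r k l : ℕ) : ℝ :=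
  gameVal (Qem E r k l) (bPred E P)

/-- `|E(S, T)|`, the number of edges between `S` and `T`. -/
def edgeCount {X Y : Type*} (E : Finset (X × Y)) (S : Finset X) (T : Finset Y) : ℕ :=
  (E.filter fun e => e.1 ∈ S ∧ e.2 ∈ T).card

/-- The event `(1 - δ)·s ≤ |E(S,T)| ≤ (1 + δ)·s`. -/
def inRange {X Y : Type*} (E : Finset (X × Y)) (s δ : ℝ) (S : Finset X) (T : Finset Y) :
    Prop :=
  (1 - δ) * s ≤ (edgeCount E S T : ℝ) ∧ (edgeCount E S T : ℝ) ≤ (1 + δ) * s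

/-- Conditioning a distribution on an event `A`. -/
def condOn {QX QY : Type*} [Fintype QX] [Fintype QY] (Q : QX → QY → ℝ)
    (A : QX → QY → Prop) : QX → QY → ℝ :=
  fun x y =>
    if A x y then Q x y / (∑ x' : QX, ∑ y' : QY, if A x' y' then Q x' y' else 0) else 0

/-- Value of `G^{k×l}_{em,[s₁,s₂]}`. -/
def birthdayEmCondVal {X Y AX AY : Type*} [Fintype X] [Fintype Y] [Fintype AX] [Fintype AY]
    [Nonempty AX] [Nonempty AY] (E : Finset (X × Y)) (P : X → Y → AX → AY → Prop)
    (r k l : ℕ) (s δ : ℝ) : ℝ :=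
  gameVal (condOn (Qem E r k l) (inRange E s δ)) (bPred E P)

/-- The set `E^{k×l}_{[s₁,s₂]}` of pairs `(S, T)` with `|S| = k`, `|T| = l` and
`(1-δ)·s ≤ |E(S,T)| ≤ (1+δ)·s`. -/
def rangeSet {X Y : Type*} [Fintype X] [Fintype Y] (E : Finset (X × Y)) (k l : ℕ)
    (s δ : ℝ) : Finset (Finset X × Finset Y) :=
  Finset.univ.filter fun p => p.1.card = k ∧ p.2.card = l ∧ inRange E s δ p.1 p.2

/-- Value of `G^{k×l}_{[s₁,s₂]}`. -/
def birthdayRangeVal {X Y AX AY : Type*} [Fintype X] [Fintype Y] [Fintype AX] [Fintype AY]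
    [Nonempty AX] [Nonempty AY] (E : Finset (X × Y)) (P : X → Y → AX → AY → Prop)
    (k l : ℕ) (s δ : ℝ) : ℝ :=
  gameVal
    (fun S T => if (S, T) ∈ rangeSet E k l s δ then ((rangeSet E k l s δ).card : ℝ)⁻¹ else 0)
    (bPred E P)

/-- Deleting `b` of `n` points multiplies the number of `k`-subsets by at most `exp (-k b / n)`. -/
lemma choose_sub_le_mul_exp (n b k : ℕ) (hb : b ≤ n) :
    ((n - b).choose k : ℝ) ≤ n.choose k * Real.exp (-((k : ℝ) * b / n)) := by
  induction b with
  | zero => simp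
  | succ b ih =>
    have ih := ih (by omega)
    obtain ⟨j, hj⟩ : ∃ j, n - b = j + 1 := ⟨n - b - 1, by omega⟩
    have hj' : n - (b + 1) = j := by omega
    rw [hj] at ih
    rw [hj']
    have hn : (0 : ℝ) < n := by exact_mod_cast (by omega : 0 < n)
    have hstep : (j.choose k : ℝ) ≤ (j + 1).choose k * Real.exp (-((k : ℝ) / n)) := by
      by_cases hk : k ≤ j + 1
      · have h := Nat.choose_mul_succ_eq j k
        have h' : (j.choose k : ℝ) * (j + 1) = (j + 1).choose k * ((j + 1 : ℝ) - k) := by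
          have := congrArg (Nat.cast (R := ℝ)) h
          push_cast [Nat.cast_sub hk] at this
          exact this
        have hjn : ((j : ℝ) + 1) ≤ n := by exact_mod_cast (by omega : j + 1 ≤ n)
        have hj0 : (0 : ℝ) < (j : ℝ) + 1 := by positivity
        have h1 : (j.choose k : ℝ) = (j + 1).choose k * (1 - k / ((j : ℝ) + 1)) := by
          field_simp
          linarith
        rw [h1]
        refine mul_le_mul_of_nonneg_left ?_ (by positivity)
        have h2 : (k : ℝ) / n ≤ k / ((j : ℝ) + 1) :=
          div_le_div_of_nonneg_left (by positivity) hj0 hjn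
        have h3 := Real.add_one_le_exp (-((k : ℝ) / n))
        linarith
      · rw [Nat.choose_eq_zero_of_lt (by omega : j < k)]
        push_cast
        positivity
    calc (j.choose k : ℝ) ≤ (j + 1).choose k * Real.exp (-((k : ℝ) / n)) := hstep
      _ ≤ (n.choose k * Real.exp (-((k : ℝ) * b / n))) * Real.exp (-((k : ℝ) / n)) :=
          mul_le_mul_of_nonneg_right ih (Real.exp_pos _).le
      _ = n.choose k * Real.exp (-((k : ℝ) * (b + 1 : ℕ) / n)) := by
          rw [mul_assoc, ← Real.exp_add]
          congr 2
          push_cast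
          ring

lemma card_powersetCard_disjoint_le {X : Type*} [Fintype X] (B : Finset X) (k : ℕ) :
    (((powersetCard k (univ : Finset X)).filter fun S => Disjoint B S).card : ℝ) ≤
      (Fintype.card X).choose k * Real.exp (-((k : ℝ) * B.card / Fintype.card X)) := by
  have h : ((powersetCard k (univ : Finset X)).filter fun S => Disjoint B S)
      = powersetCard k Bᶜ := by
    ext S
    simp only [mem_filter, mem_powersetCard, subset_univ, true_and]
    rw [and_comm, disjoint_comm, ← le_compl_iff_disjoint_right]
  rw [h, card_powersetCard, card_compl]
  exact choose_sub_le_mul_exp _ _ _ (card_le_univ B)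

/-- The exponential moment of the hypergeometric distribution at `1 / 2`. -/
lemma sum_half_pow_card_inter_le {Y : Type*} [Fintype Y] (U : Finset Y) (l : ℕ)
    (hl : l ≤ Fintype.card Y) :
    ∑ T ∈ powersetCard l (univ : Finset Y), (1 / 2 : ℝ) ^ (U ∩ T).card ≤
      (Fintype.card Y).choose l *
        Real.exp (-((U.card : ℝ) * (l / Fintype.card Y) / 4)) := by
  set m := Fintype.card Y
  set t : ℝ := (l : ℝ) / m with ht
  have ht0 : 0 ≤ t := by positivity
  have ht1 : t ≤ 1 := div_le_one_of_le₀ (by exact_mod_cast hl) (by positivity)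
  have hcount : ∀ T : Finset Y, (1 / 2 : ℝ) ^ (U ∩ T).card =
      (1 / 2) ^ U.card * ∑ V ∈ U.powerset, if Disjoint V T then 1 else 0 := by
    intro T
    have h1 : U.powerset.filter (fun V => Disjoint V T) = (U \ T).powerset := by
      ext V
      simp only [mem_filter, mem_powerset]
      rw [subset_sdiff]
    rw [← sum_filter, sum_const, h1, card_powerset, nsmul_eq_mul, mul_one,
      ← card_sdiff_add_card_inter U T, pow_add]
    push_cast
    rw [mul_right_comm, ← mul_pow]
    norm_num
  have hexp : 1 + Real.exp (-t) ≤ 2 * Real.exp (-(t / 4)) := by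
    have h1 := Real.add_one_le_exp (-(t / 4))
    have h2 : Real.exp (-t) ≤ 1 - t / 2 := by
      have h3 : 1 + t ≤ Real.exp t := by linarith [Real.add_one_le_exp t]
      rw [Real.exp_neg, inv_eq_one_div, div_le_iff₀ (Real.exp_pos t)]
      nlinarith
    linarith
  calc ∑ T ∈ powersetCard l (univ : Finset Y), (1 / 2 : ℝ) ^ (U ∩ T).card
      = (1 / 2) ^ U.card * ∑ V ∈ U.powerset,
          (((powersetCard l (univ : Finset Y)).filter fun T => Disjoint V T).card : ℝ) := by
        simp_rw [hcount]
        rw [← mul_sum, sum_comm]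
        congr 1
        refine sum_congr rfl fun V _ => ?_
        rw [← sum_filter, sum_const, nsmul_eq_mul, mul_one]
    _ ≤ (1 / 2) ^ U.card * ∑ V ∈ U.powerset, (m.choose l : ℝ) * Real.exp (-t) ^ V.card := by
        refine mul_le_mul_of_nonneg_left (sum_le_sum fun V _ => ?_) (by positivity)
        refine (card_powersetCard_disjoint_le V l).trans (le_of_eq ?_)
        rw [← Real.exp_nat_mul]
        congr 2
        rw [ht]
        ring
    _ = m.choose l * ((1 / 2) * (1 + Real.exp (-t))) ^ U.card := by
        rw [← mul_sum, mul_pow, add_comm, ← Finset.sum_pow_mul_eq_add_pow]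
        simp only [one_pow, mul_one]
        ring
    _ ≤ m.choose l * (Real.exp (-(t / 4))) ^ U.card := by
        refine mul_le_mul_of_nonneg_left (pow_le_pow_left₀ (by positivity) ?_ _) (by positivity)
        linarith
    _ = _ := by
        rw [← Real.exp_nat_mul]
        congr 2
        ring

/-- If every point of `U` is covered by few members of a family of `l`-sets, then the family
is exponentially small. -/
lemma card_le_of_low_marginals {Y : Type*} [Fintype Y] (U : Finset Y) (l : ℕ)
    (hl : l ≤ Fintype.card Y) (F : Finset (Finset Y))
    (hF : F ⊆ powersetCard l univ)
    (hU : ∀ y ∈ U, ((F.filter fun T => y ∈ T).card : ℝ) ≤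
      (l / Fintype.card Y : ℝ) / 4 * F.card) :
    (F.card : ℝ) ≤ (Fintype.card Y).choose l *
      Real.exp (-((U.card : ℝ) * (l / Fintype.card Y) / 16)) := by
  set m := Fintype.card Y
  set t : ℝ := (l : ℝ) / m with ht
  have ht0 : 0 ≤ t := by positivity
  have hlog := Real.log_two_lt_d9
  have hlog0 : 0 < Real.log 2 := Real.log_pos (by norm_num)
  set μ : ℝ := U.card * t / 4 with hμ
  have hμ0 : 0 ≤ μ := by positivity
  have hmean : ∑ T ∈ F, ((U ∩ T).card : ℝ) ≤ μ * F.card := by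
    have h1 : ∑ T ∈ F, ((U ∩ T).card : ℝ) = ∑ y ∈ U, ((F.filter fun T => y ∈ T).card : ℝ) := by
      simp_rw [← filter_mem_eq_inter, card_filter]
      push_cast
      rw [sum_comm]
    rw [h1]
    refine (sum_le_sum hU).trans (le_of_eq ?_)
    rw [sum_const, nsmul_eq_mul, hμ]
    ring
  have hpt : ∀ T : Finset Y, Real.exp (-(Real.log 2 * μ)) *
      (1 - Real.log 2 * ((U ∩ T).card - μ)) ≤ (1 / 2 : ℝ) ^ (U ∩ T).card := by
    intro T
    have h1 : (1 / 2 : ℝ) ^ (U ∩ T).card = Real.exp (-(Real.log 2 * μ)) *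
        Real.exp (-(Real.log 2 * ((U ∩ T).card - μ))) := by
      rw [← Real.exp_add, one_div, ← Real.exp_log (show (0 : ℝ) < 2⁻¹ by norm_num),
        ← Real.exp_nat_mul, Real.log_inv]
      congr 1
      ring
    rw [h1]
    refine mul_le_mul_of_nonneg_left ?_ (Real.exp_pos _).le
    have := Real.add_one_le_exp (-(Real.log 2 * ((U ∩ T).card - μ)))
    linarith
  have hlow : Real.exp (-(Real.log 2 * μ)) * F.card ≤
      m.choose l * Real.exp (-((U.card : ℝ) * t / 4)) := by
    calc Real.exp (-(Real.log 2 * μ)) * F.card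
        ≤ ∑ T ∈ F, Real.exp (-(Real.log 2 * μ)) * (1 - Real.log 2 * ((U ∩ T).card - μ)) := by
          rw [← mul_sum]
          refine mul_le_mul_of_nonneg_left ?_ (Real.exp_pos _).le
          rw [sum_sub_distrib, ← mul_sum, sum_sub_distrib]
          simp only [sum_const, nsmul_eq_mul]
          nlinarith
      _ ≤ ∑ T ∈ F, (1 / 2 : ℝ) ^ (U ∩ T).card := sum_le_sum fun T _ => hpt T
      _ ≤ ∑ T ∈ powersetCard l (univ : Finset Y), (1 / 2 : ℝ) ^ (U ∩ T).card :=
          sum_le_sum_of_subset_of_nonneg hF fun _ _ _ => by positivity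
      _ ≤ _ := sum_half_pow_card_inter_le U l hl
  have h2 : (F.card : ℝ) ≤ m.choose l * Real.exp (-((U.card : ℝ) * t / 4)) *
      Real.exp (Real.log 2 * μ) := by
    rw [Real.exp_neg, inv_mul_le_iff₀ (Real.exp_pos _)] at hlow
    linarith
  refine h2.trans ?_
  rw [mul_assoc, ← Real.exp_add]
  refine mul_le_mul_of_nonneg_left (Real.exp_le_exp.2 ?_) (by positivity)
  have : (U.card : ℝ) * t = 4 * μ := by rw [hμ]; ring
  rw [this]
  nlinarith

lemma card_filter_snd_mem_le {X Y : Type*} [Fintype X] [Fintype Y] (E : Finset (X × Y))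
    (U : Finset Y) : (E.filter fun e => e.2 ∈ U).card ≤ maxDeg E * U.card := by
  refine card_le_mul_card_image_of_maps_to (f := Prod.snd) (t := U)
    (fun e he => (mem_filter.1 he).2) _ fun y hy => ?_
  refine le_trans (card_le_card ?_) (le_trans
    (Finset.le_sup (f := fun y : Y => (E.filter fun e => e.2 = y).card) (mem_univ y))
    (le_max_right _ _))
  intro e he
  simp only [mem_filter] at he ⊢
  exact ⟨he.1.1, he.2⟩

lemma card_filter_fst_mem_le {X Y : Type*} [Fintype X] [Fintype Y] (E : Finset (X × Y))
    (B : Finset X) : (E.filter fun e => e.1 ∈ B).card ≤ maxDeg E * B.card := by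
  refine card_le_mul_card_image_of_maps_to (f := Prod.fst) (t := B)
    (fun e he => (mem_filter.1 he).2) _ fun x hx => ?_
  refine le_trans (card_le_card ?_) (le_trans
    (Finset.le_sup (f := fun x : X => (E.filter fun e => e.1 = x).card) (mem_univ x))
    (le_max_left _ _))
  intro e he
  simp only [mem_filter] at he ⊢
  exact ⟨he.1.1, he.2⟩

/-- The edges whose right endpoint lies in none of the sets `t i`. -/
def uncovered {X Y : Type*} (E : Finset (X × Y)) {q : ℕ} (t : Fin q → Finset Y) :
    Finset (X × Y) :=
  E.filter fun e => ∀ i, e.2 ∉ t i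

/-- In a family of `l`-sets that is not exponentially small, the points with low marginals
touch few edges. -/
lemma maxDeg_mul_card_low_marginals_le {X Y : Type*} [Fintype X] [Fintype Y]
    (E : Finset (X × Y)) (hd : (0 : ℝ) < maxDeg E) (hn : (0 : ℝ) < Fintype.card X) (ε : ℝ)
    (hε : 0 < ε) (hε1 : ε ≤ 1) (k l : ℕ) (hl0 : 0 < l) (hk : k ≤ Fintype.card X)
    (hl : l ≤ Fintype.card Y) (F : Finset (Finset Y)) (hF : F ⊆ powersetCard l univ)
    (hFc : (Fintype.card Y).choose l * Real.exp (-(1 / 128 * ε ^ 2 *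
      ((k : ℝ) * l * E.card / (maxDeg E * Fintype.card X * Fintype.card Y)))) < F.card) :
    (maxDeg E : ℝ) * ((univ.filter fun y : Y => ((F.filter fun T => y ∈ T).card : ℝ) ≤
      (l / Fintype.card Y : ℝ) / 4 * F.card).card : ℝ) ≤ ε * E.card / 8 := by
  have h1 := card_le_of_low_marginals (univ.filter fun y : Y =>
    ((F.filter fun T => y ∈ T).card : ℝ) ≤ (l / Fintype.card Y : ℝ) / 4 * F.card) l hl F hF
    (fun y hy => (mem_filter.1 hy).2)
  generalize ((univ.filter fun y : Y => ((F.filter fun T => y ∈ T).card : ℝ) ≤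
      (l / Fintype.card Y : ℝ) / 4 * F.card).card : ℝ) = u at h1 ⊢
  have hm : (0 : ℝ) < Fintype.card Y := by exact_mod_cast hl0.trans_le hl
  have hl' : (0 : ℝ) < l := by exact_mod_cast hl0
  have hkn : (k : ℝ) ≤ Fintype.card X := by exact_mod_cast hk
  have hL : (0 : ℝ) < (Fintype.card Y).choose l := by exact_mod_cast Nat.choose_pos hl
  generalize (maxDeg E : ℝ) = d at *
  generalize (Fintype.card X : ℝ) = n at *
  generalize (Fintype.card Y : ℝ) = m at *
  have h2 := Real.exp_lt_exp.1 (lt_of_mul_lt_mul_left (hFc.trans_le h1) hL.le)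
  have h3 : u ≤ 16 * (1 / 128 * ε ^ 2 * ((k : ℝ) * l * E.card / (d * n * m))) / (l / m) := by
    rw [le_div_iff₀ (by positivity)]
    linarith
  calc d * u ≤ d * (16 * (1 / 128 * ε ^ 2 * ((k : ℝ) * l * E.card / (d * n * m))) / (l / m)) :=
        mul_le_mul_of_nonneg_left h3 hd.le
    _ = ε * E.card / 8 * (ε * (k / n)) := by field_simp; ring
    _ ≤ ε * E.card / 8 * 1 := by
        refine mul_le_mul_of_nonneg_left ?_ (by positivity)
        exact mul_le_one₀ hε1 (by positivity) (div_le_one_of_le₀ hkn hn.le)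
    _ = _ := mul_one _

lemma card_tuples_avoiding {Y : Type*} (F : Finset (Finset Y)) (q : ℕ) (y : Y) :
    ((Fintype.piFinset fun _ : Fin q => F).filter fun t => ∀ i, y ∉ t i).card =
      (F.filter fun T => y ∉ T).card ^ q := by
  have h : ((Fintype.piFinset fun _ : Fin q => F).filter fun t => ∀ i, y ∉ t i) =
      Fintype.piFinset fun _ : Fin q => F.filter fun T => y ∉ T := by
    ext t
    simp [Fintype.mem_piFinset, forall_and]
  rw [h, Fintype.card_piFinset]
  simp

/-- Most tuples from a large family of `l`-sets cover almost all edges. -/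
lemma card_covering_tuples_ge {X Y : Type*} [Fintype X] [Fintype Y] (E : Finset (X × Y))
    (hE : E.Nonempty) (l q : ℕ) (F : Finset (Finset Y)) (ε : ℝ) (hε : 0 < ε)
    (hU : (maxDeg E : ℝ) * ((univ.filter fun y : Y => ((F.filter fun T => y ∈ T).card : ℝ) ≤
      (l / Fintype.card Y : ℝ) / 4 * F.card).card : ℝ) ≤ ε * E.card / 8)
    (hl : l ≤ Fintype.card Y)
    (hq : 8 / ε ≤ q * (l / Fintype.card Y : ℝ) / 4) :
    (F.card : ℝ) ^ q / 2 ≤ (((Fintype.piFinset fun _ : Fin q => F).filter fun t =>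
      ((uncovered E t).card : ℝ) ≤ ε / 2 * E.card).card : ℝ) := by
  set s : ℝ := (l : ℝ) / Fintype.card Y with hs
  have hs0 : 0 ≤ s := by positivity
  have hs1 : s ≤ 1 := div_le_one_of_le₀ (by exact_mod_cast hl) (by positivity)
  set U := univ.filter fun y : Y => ((F.filter fun T => y ∈ T).card : ℝ) ≤ s / 4 * F.card with hUd
  set A := Fintype.piFinset fun _ : Fin q => F with hA
  have hEc : (0 : ℝ) < E.card := by exact_mod_cast hE.card_pos
  have hN0 : (0 : ℝ) ≤ (F.card : ℝ) ^ q := by positivity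
  have hA_card : (A.card : ℝ) = (F.card : ℝ) ^ q := by simp [hA, Fintype.card_piFinset]
  have hdecay : (1 - s / 4) ^ q ≤ ε / 8 := by
    calc (1 - s / 4) ^ q ≤ Real.exp (-(s / 4)) ^ q :=
          pow_le_pow_left₀ (by linarith) (by linarith [Real.add_one_le_exp (-(s / 4))]) _
      _ = Real.exp (-(q * s / 4)) := by rw [← Real.exp_nat_mul]; congr 1; ring
      _ ≤ Real.exp (-(8 / ε)) := Real.exp_le_exp.2 (by linarith)
      _ ≤ (8 / ε)⁻¹ := by
          rw [Real.exp_neg]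
          exact inv_anti₀ (by positivity) (by linarith [Real.add_one_le_exp (8 / ε)])
      _ = ε / 8 := by rw [inv_div]
  have hedge : ∀ e ∈ E, (((F.filter fun T => e.2 ∉ T).card : ℝ)) ^ q ≤
      (F.card : ℝ) ^ q * (ε / 8) + (if e.2 ∈ U then (F.card : ℝ) ^ q else 0) := by
    intro e _
    have hsum : ((F.filter fun T => e.2 ∈ T).card : ℝ) + (F.filter fun T => e.2 ∉ T).card
        = F.card := by
      exact_mod_cast card_filter_add_card_filter_not (s := F) (fun T => e.2 ∈ T)
    have hpos : (0 : ℝ) ≤ (F.filter fun T => e.2 ∈ T).card := by positivity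
    split_ifs with h
    · have h1 : (((F.filter fun T => e.2 ∉ T).card : ℝ)) ^ q ≤ (F.card : ℝ) ^ q :=
        pow_le_pow_left₀ (by positivity) (by linarith) _
      have h2 : 0 ≤ (F.card : ℝ) ^ q * (ε / 8) := by positivity
      linarith
    · have h' : s / 4 * F.card < ((F.filter fun T => e.2 ∈ T).card : ℝ) := by
        by_contra hc
        exact h (by simp only [hUd, mem_filter, mem_univ, true_and]; linarith)
      calc (((F.filter fun T => e.2 ∉ T).card : ℝ)) ^ q
          ≤ (F.card * (1 - s / 4)) ^ q := pow_le_pow_left₀ (by positivity) (by linarith) _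
        _ = (F.card : ℝ) ^ q * (1 - s / 4) ^ q := mul_pow _ _ _
        _ ≤ (F.card : ℝ) ^ q * (ε / 8) := mul_le_mul_of_nonneg_left hdecay hN0
        _ = _ := by ring
  have htotal : ∑ t ∈ A, ((uncovered E t).card : ℝ) ≤ (F.card : ℝ) ^ q * (ε * E.card / 4) := by
    calc ∑ t ∈ A, ((uncovered E t).card : ℝ)
        = ∑ e ∈ E, (((F.filter fun T => e.2 ∉ T).card : ℝ)) ^ q := by
          simp_rw [uncovered, card_filter _ E]
          push_cast
          rw [sum_comm]
          refine sum_congr rfl fun e _ => ?_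
          rw [← sum_filter, sum_const, nsmul_eq_mul, mul_one]
          exact_mod_cast card_tuples_avoiding F q e.2
      _ ≤ ∑ e ∈ E, ((F.card : ℝ) ^ q * (ε / 8) + (if e.2 ∈ U then (F.card : ℝ) ^ q else 0)) :=
          sum_le_sum hedge
      _ = (F.card : ℝ) ^ q * (ε * E.card / 8) +
          (F.card : ℝ) ^ q * ((E.filter fun e => e.2 ∈ U).card : ℝ) := by
          rw [sum_add_distrib, ← sum_filter]
          simp only [sum_const, nsmul_eq_mul]
          ring
      _ ≤ (F.card : ℝ) ^ q * (ε * E.card / 8) + (F.card : ℝ) ^ q * (ε * E.card / 8) := by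
          gcongr
          refine le_trans ?_ hU
          exact_mod_cast card_filter_snd_mem_le E U
      _ = _ := by ring
  have hsplit : ((A.filter fun t => ((uncovered E t).card : ℝ) ≤ ε / 2 * E.card).card : ℝ) +
      (A.filter fun t => ¬ ((uncovered E t).card : ℝ) ≤ ε / 2 * E.card).card =
      (F.card : ℝ) ^ q := by
    rw [← hA_card]
    exact_mod_cast card_filter_add_card_filter_not (s := A)
      (fun t => ((uncovered E t).card : ℝ) ≤ ε / 2 * E.card)
  have hmarkov : ((A.filter fun t => ¬ ((uncovered E t).card : ℝ) ≤ ε / 2 * E.card).card : ℝ) *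
      (ε / 2 * E.card) ≤ (F.card : ℝ) ^ q * (ε * E.card / 4) := by
    refine le_trans ?_ htotal
    rw [← nsmul_eq_mul, ← sum_const]
    refine (sum_le_sum fun t ht => ?_).trans
      (sum_le_sum_of_subset_of_nonneg (filter_subset _ _) fun _ _ _ => by positivity)
    exact (not_le.1 (mem_filter.1 ht).2).le
  have hb : ((A.filter fun t => ¬ ((uncovered E t).card : ℝ) ≤ ε / 2 * E.card).card : ℝ) ≤
      (F.card : ℝ) ^ q / 2 := by
    have hpos : 0 < ε / 2 * E.card := by positivity
    refine le_of_mul_le_mul_right (hmarkov.trans (le_of_eq ?_)) hpos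
    ring
  linarith

lemma sum_unifOn_mul {X Y : Type*} [Fintype X] [Fintype Y] (E : Finset (X × Y))
    (R : X → Y → Prop) :
    ∑ x : X, ∑ y : Y, unifOn E x y * (if R x y then (1 : ℝ) else 0) =
      ((E.filter fun e => R e.1 e.2).card : ℝ) * (E.card : ℝ)⁻¹ := by
  rw [← Fintype.sum_prod_type' (f := fun x y => unifOn E x y * (if R x y then (1 : ℝ) else 0)),
    card_filter]
  push_cast
  rw [sum_mul, ← sum_subset (subset_univ E)]
  · refine sum_congr rfl fun e he => ?_
    simp only [unifOn, Prod.mk.eta, he, if_true]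
    ring
  · intro e _ he
    simp [unifOn, he]

lemma exists_gameVal_eq {QX QY AX AY : Type*} [Fintype QX] [Fintype QY] [Fintype AX]
    [Fintype AY] [Nonempty AX] [Nonempty AY] (Q : QX → QY → ℝ)
    (P : QX → QY → AX → AY → Prop) :
    ∃ (f : QX → AX) (g : QY → AY), gameVal Q P =
      ∑ x : QX, ∑ y : QY, Q x y * (if P x y (f x) (g y) then 1 else 0) := by
  unfold gameVal
  obtain ⟨φ, _, hφ⟩ := Finset.exists_mem_eq_sup'
    (s := (univ : Finset ((QX → AX) × (QY → AY))))
    ⟨(fun _ => Classical.arbitrary AX, fun _ => Classical.arbitrary AY), mem_univ _⟩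
    (fun φ => ∑ x : QX, ∑ y : QY, Q x y * (if P x y (φ.1 x) (φ.2 y) then (1 : ℝ) else 0))
  exact ⟨φ.1, φ.2, hφ⟩

lemma gameVal_unifOn_le_one {X Y AX AY : Type*} [Fintype X] [Fintype Y] [Fintype AX]
    [Fintype AY] [Nonempty AX] [Nonempty AY] (E : Finset (X × Y))
    (P : X → Y → AX → AY → Prop) : gameVal (unifOn E) P ≤ 1 := by
  obtain ⟨f, g, h⟩ := exists_gameVal_eq (unifOn E) P
  rw [h, sum_unifOn_mul E fun x y => P x y (f x) (g y), ← div_eq_mul_inv]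
  exact div_le_one_of_le₀ (by exact_mod_cast card_filter_le _ _) (by positivity)

lemma card_satisfied_le {X Y AX AY : Type*} [Fintype X] [Fintype Y] [Fintype AX] [Fintype AY]
    [Nonempty AX] [Nonempty AY] (E : Finset (X × Y)) (hE : E.Nonempty)
    (P : X → Y → AX → AY → Prop) (f : X → AX) (g : Y → AY) :
    ((E.filter fun e => P e.1 e.2 (f e.1) (g e.2)).card : ℝ) ≤
      gameVal (unifOn E) P * E.card := by
  have hEc : (0 : ℝ) < E.card := by exact_mod_cast hE.card_pos
  have h := Finset.le_sup' (s := (univ : Finset ((X → AX) × (Y → AY))))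
    (f := fun φ => ∑ x : X, ∑ y : Y, unifOn E x y * (if P x y (φ.1 x) (φ.2 y) then (1 : ℝ) else 0))
    (mem_univ (f, g))
  rw [← div_le_iff₀ hEc, div_eq_mul_inv, ← sum_unifOn_mul E fun x y => P x y (f x) (g y)]
  exact h

/-- A fixed tuple of right questions that covers almost all edges is won simultaneously by
only few left questions. -/
lemma card_winning_sets_le {X Y AX AY : Type*} [Fintype X] [Fintype Y] [Fintype AX]
    [Fintype AY] [Nonempty AX] [Nonempty AY] (E : Finset (X × Y)) (hE : E.Nonempty)
    (P : X → Y → AX → AY → Prop) (ε : ℝ) (hval : gameVal (unifOn E) P = 1 - ε)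
    (a : Finset X → X → AX) (b : Finset Y → Y → AY) (k q : ℕ) (t : Fin q → Finset Y)
    (ht : ((uncovered E t).card : ℝ) ≤ ε / 2 * E.card) :
    (((powersetCard k (univ : Finset X)).filter fun S =>
      ∀ i, bPred E P S (t i) (a S) (b (t i))).card : ℝ) ≤
      (Fintype.card X).choose k *
        Real.exp (-((k : ℝ) * (ε * E.card / (2 * maxDeg E)) / Fintype.card X)) := by
  obtain ⟨g, hg⟩ : ∃ g : Y → AY, ∀ y, (∃ i, y ∈ t i) → ∃ i, y ∈ t i ∧ g y = b (t i) y := by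
    have : ∀ y, ∃ c : AY, (∃ i, y ∈ t i) → ∃ i, y ∈ t i ∧ c = b (t i) y := by
      intro y
      by_cases h : ∃ i, y ∈ t i
      · obtain ⟨i, hi⟩ := h
        exact ⟨b (t i) y, fun _ => ⟨i, hi, rfl⟩⟩
      · exact ⟨Classical.arbitrary AY, fun h' => absurd h' h⟩
    choose g hg using this
    exact ⟨g, hg⟩
  set good : X → AX → Prop :=
    fun x c => ∀ y, (x, y) ∈ E → (∃ i, y ∈ t i) → P x y c (g y) with hgood
  set B : Finset X := univ.filter fun x => ¬ ∃ c, good x c with hB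
  obtain ⟨f, hf⟩ : ∃ f : X → AX, ∀ x, (∃ c, good x c) → good x (f x) := by
    have : ∀ x, ∃ c : AX, (∃ c, good x c) → good x c := by
      intro x
      by_cases h : ∃ c, good x c
      · exact ⟨h.choose, fun _ => h.choose_spec⟩
      · exact ⟨Classical.arbitrary AX, fun h' => absurd h' h⟩
    choose f hf using this
    exact ⟨f, hf⟩
  have hsub : E ⊆ (E.filter fun e => P e.1 e.2 (f e.1) (g e.2)) ∪
      ((E.filter fun e => e.1 ∈ B) ∪ uncovered E t) := by
    intro e he
    by_cases h1 : e.1 ∈ B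
    · exact mem_union_right _ (mem_union_left _ (mem_filter.2 ⟨he, h1⟩))
    by_cases h2 : ∃ i, e.2 ∈ t i
    · refine mem_union_left _ (mem_filter.2 ⟨he, ?_⟩)
      have h3 : ∃ c, good e.1 c := by
        by_contra hc
        exact h1 (by simp only [hB, mem_filter, mem_univ, true_and]; exact hc)
      exact hf e.1 h3 e.2 he h2
    · refine mem_union_right _ (mem_union_right _ (mem_filter.2 ⟨he, ?_⟩))
      push Not at h2
      exact h2
  have hcount : (E.card : ℝ) ≤ (1 - ε) * E.card + (maxDeg E * B.card + ε / 2 * E.card) := by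
    have h1 := card_satisfied_le E hE P f g
    rw [hval] at h1
    have h2 : ((E.filter fun e => e.1 ∈ B).card : ℝ) ≤ maxDeg E * B.card := by
      exact_mod_cast card_filter_fst_mem_le E B
    have h3 : (E.card : ℝ) ≤ (E.filter fun e => P e.1 e.2 (f e.1) (g e.2)).card +
        ((E.filter fun e => e.1 ∈ B).card + (uncovered E t).card) := by
      exact_mod_cast (card_le_card hsub).trans
        ((card_union_le _ _).trans (Nat.add_le_add_left (card_union_le _ _) _))
    linarith
  have hdiv : ε * E.card / (2 * maxDeg E) ≤ B.card := by
    refine div_le_of_le_mul₀ (by positivity) (by positivity) ?_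
    nlinarith
  calc (((powersetCard k (univ : Finset X)).filter fun S =>
      ∀ i, bPred E P S (t i) (a S) (b (t i))).card : ℝ)
      ≤ (((powersetCard k (univ : Finset X)).filter fun S => Disjoint B S).card : ℝ) := by
        refine Nat.cast_le.2 (card_le_card fun S hS => ?_)
        rw [mem_filter] at hS ⊢
        refine ⟨hS.1, disjoint_left.2 fun x hxB hxS => ?_⟩
        refine (mem_filter.1 hxB).2 ⟨a S x, fun y hy hcov => ?_⟩
        obtain ⟨i, hi, hgi⟩ := hg y hcov
        rw [hgi]
        exact hS.2 i x hxS y hi hy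
    _ ≤ _ := card_powersetCard_disjoint_le B k
    _ ≤ _ := by gcongr

lemma exists_birthdayVal_eq {X Y AX AY : Type*} [Fintype X] [Fintype Y] [Fintype AX]
    [Fintype AY] [Nonempty AX] [Nonempty AY] (E : Finset (X × Y))
    (P : X → Y → AX → AY → Prop) (k l : ℕ) :
    ∃ (a : Finset X → X → AX) (b : Finset Y → Y → AY),
      birthdayVal E P k l =
        ((((Fintype.card X).choose k : ℝ) * ((Fintype.card Y).choose l : ℝ))⁻¹) *
        ∑ S ∈ powersetCard k (univ : Finset X),
          (((powersetCard l (univ : Finset Y)).filter fun T =>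
            bPred E P S T (a S) (b T)).card : ℝ) := by
  obtain ⟨a, b, h⟩ := exists_gameVal_eq (fun (S : Finset X) (T : Finset Y) =>
      if S.card = k ∧ T.card = l then
        (((Fintype.card X).choose k : ℝ) * ((Fintype.card Y).choose l : ℝ))⁻¹
      else 0) (bPred E P)
  refine ⟨a, b, ?_⟩
  rw [birthdayVal, h, mul_sum]
  have hX : powersetCard k (univ : Finset X) = univ.filter fun S => S.card = k := by
    ext S
    simp [mem_powersetCard]
  have hY : powersetCard l (univ : Finset Y) = univ.filter fun S => S.card = l := by
    ext S
    simp [mem_powersetCard]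
  rw [hX, sum_filter]
  refine sum_congr rfl fun S _ => ?_
  by_cases hS : S.card = k
  · rw [if_pos hS, card_filter]
    push_cast
    rw [mul_sum, hY, sum_filter]
    refine sum_congr rfl fun T _ => ?_
    by_cases hT : T.card = l
    · rw [if_pos ⟨hS, hT⟩, if_pos hT]
    · rw [if_neg fun h => hT h.2, if_neg hT, zero_mul]
  · rw [if_neg hS]
    exact sum_eq_zero fun T _ => by rw [if_neg fun h => hS h.1, zero_mul]

lemma birthdayVal_le_one {X Y AX AY : Type*} [Fintype X] [Fintype Y] [Fintype AX]
    [Fintype AY] [Nonempty AX] [Nonempty AY] (E : Finset (X × Y))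
    (P : X → Y → AX → AY → Prop) (k l : ℕ) : birthdayVal E P k l ≤ 1 := by
  obtain ⟨a, b, h⟩ := exists_birthdayVal_eq E P k l
  rw [h, inv_mul_eq_div]
  refine div_le_one_of_le₀ ?_ (by positivity)
  calc _ ≤ ∑ S ∈ powersetCard k (univ : Finset X), ((Fintype.card Y).choose l : ℝ) := by
        refine sum_le_sum fun S _ => Nat.cast_le.2 ((card_filter_le _ _).trans ?_)
        rw [card_powersetCard, card_univ]
    _ = _ := by rw [sum_const, card_powersetCard, card_univ, nsmul_eq_mul]

lemma card_le_maxDeg_mul_card {X Y : Type*} [Fintype X] [Fintype Y] (E : Finset (X × Y)) :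
    E.card ≤ maxDeg E * Fintype.card X := by
  simpa using card_filter_fst_mem_le E univ

/-- If the value of the birthday repetition is not exponentially small, then its powers are
bounded by the probability of winning against a fixed covering tuple of right questions. -/
lemma half_birthdayVal_pow_le {X Y AX AY : Type*} [Fintype X] [Fintype Y] [Fintype AX]
    [Fintype AY] [Nonempty AX] [Nonempty AY] (E : Finset (X × Y)) (hE : E.Nonempty)
    (hd : (0 : ℝ) < maxDeg E) (hn : (0 : ℝ) < Fintype.card X)
    (P : X → Y → AX → AY → Prop) (ε : ℝ) (hε : 0 < ε) (hε1 : ε ≤ 1)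
    (hval : gameVal (unifOn E) P = 1 - ε) (k l : ℕ) (hl0 : 0 < l)
    (hk : k ≤ Fintype.card X) (hl : l ≤ Fintype.card Y)
    (hcon : Real.exp (-(1 / 128 * ε ^ 2 *
      ((k : ℝ) * l * E.card / (maxDeg E * Fintype.card X * Fintype.card Y)))) <
        birthdayVal E P k l / 2)
    (q : ℕ) (hq : 8 / ε ≤ q * (l / Fintype.card Y : ℝ) / 4) :
    (birthdayVal E P k l / 2) ^ (q + 2) ≤
      Real.exp (-((k : ℝ) * (ε * E.card / (2 * maxDeg E)) / Fintype.card X)) := by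
  obtain ⟨a, b, hp⟩ := exists_birthdayVal_eq E P k l
  have hp1 := birthdayVal_le_one E P k l
  have hK : (0 : ℝ) < (Fintype.card X).choose k := by exact_mod_cast Nat.choose_pos hk
  have hL : (0 : ℝ) < (Fintype.card Y).choose l := by exact_mod_cast Nat.choose_pos hl
  have hPl : (powersetCard l (univ : Finset Y)).card = (Fintype.card Y).choose l := by
    rw [card_powersetCard, card_univ]
  have hPk : (powersetCard k (univ : Finset X)).card = (Fintype.card X).choose k := by
    rw [card_powersetCard, card_univ]
  set K : ℝ := ((Fintype.card X).choose k : ℝ) with hKd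
  set L : ℝ := ((Fintype.card Y).choose l : ℝ) with hLd
  set r : ℝ := birthdayVal E P k l / 2 with hr
  have hr0 : 0 < r := (Real.exp_pos _).trans hcon
  have hr1 : r ≤ 1 / 2 := by rw [hr]; linarith
  set F : Finset X → Finset (Finset Y) := fun S =>
    (powersetCard l (univ : Finset Y)).filter fun T => bPred E P S T (a S) (b T) with hF
  have hFL : ∀ S, ((F S).card : ℝ) ≤ L := by
    intro S
    rw [hLd, ← hPl]
    exact_mod_cast card_filter_le _ _
  have hsumF : ∑ S ∈ powersetCard k (univ : Finset X), ((F S).card : ℝ) = 2 * r * (K * L) := by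
    rw [hr, hp]
    field_simp
    rfl
  set G := (powersetCard k (univ : Finset X)).filter fun S => r * L ≤ ((F S).card : ℝ) with hG
  have hGc : r * K ≤ G.card := by
    have h1 : ∑ S ∈ powersetCard k (univ : Finset X), ((F S).card : ℝ) ≤
        ∑ S ∈ powersetCard k (univ : Finset X),
          ((if r * L ≤ ((F S).card : ℝ) then L else 0) + r * L) := by
      refine sum_le_sum fun S _ => ?_
      split_ifs with h
      · have := hFL S
        have : 0 ≤ r * L := by positivity
        linarith
      · linarith
    rw [hsumF, sum_add_distrib, ← sum_filter, sum_const, sum_const, hPk, nsmul_eq_mul,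
      nsmul_eq_mul, ← hG, ← hKd] at h1
    refine le_of_mul_le_mul_right ?_ hL
    linarith
  set cov : (Fin q → Finset Y) → Prop :=
    fun t => ((uncovered E t).card : ℝ) ≤ ε / 2 * E.card with hcov
  have hgood : ∀ S ∈ G, (r * L) ^ q / 2 ≤
      (((Fintype.piFinset fun _ : Fin q => F S).filter cov).card : ℝ) := by
    intro S hS
    have hSF : r * L ≤ ((F S).card : ℝ) := (mem_filter.1 hS).2
    refine le_trans ?_ (card_covering_tuples_ge E hE l q (F S) ε hε ?_ hl hq)
    · gcongr
    · refine maxDeg_mul_card_low_marginals_le E hd hn ε hε hε1 k l hl0 hk hl (F S)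
        (filter_subset _ _) ?_
      calc _ < L * r := mul_lt_mul_of_pos_left hcon hL
        _ = r * L := mul_comm _ _
        _ ≤ _ := hSF
  set θ : ℝ := (k : ℝ) * (ε * E.card / (2 * maxDeg E)) / Fintype.card X with hθ
  set A := (Fintype.piFinset fun _ : Fin q => powersetCard l (univ : Finset Y)).filter cov with hA
  have hAc : (A.card : ℝ) ≤ L ^ q := by
    have h1 : A.card ≤ ((Fintype.card Y).choose l) ^ q := by
      refine (card_filter_le _ _).trans ?_
      rw [Fintype.card_piFinset]
      simp
    rw [hLd]
    exact_mod_cast h1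
  have hcount : G.card * ((r * L) ^ q / 2) ≤ L ^ q * (K * Real.exp (-θ)) := by
    calc G.card * ((r * L) ^ q / 2)
        ≤ ∑ S ∈ G, (((Fintype.piFinset fun _ : Fin q => F S).filter cov).card : ℝ) := by
          rw [← nsmul_eq_mul, ← sum_const]
          exact sum_le_sum hgood
      _ ≤ ∑ S ∈ powersetCard k (univ : Finset X),
          (((Fintype.piFinset fun _ : Fin q => F S).filter cov).card : ℝ) :=
          sum_le_sum_of_subset_of_nonneg (filter_subset _ _) fun _ _ _ => Nat.cast_nonneg _
      _ = ∑ S ∈ powersetCard k (univ : Finset X),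
          ((A.filter fun t => ∀ i, bPred E P S (t i) (a S) (b (t i))).card : ℝ) := by
          refine sum_congr rfl fun S _ => ?_
          congr 2
          ext t
          rw [mem_filter, mem_filter, mem_filter, Fintype.mem_piFinset, Fintype.mem_piFinset]
          constructor
          · exact fun h => ⟨⟨fun i => (mem_filter.1 (h.1 i)).1, h.2⟩,
              fun i => (mem_filter.1 (h.1 i)).2⟩
          · exact fun h => ⟨fun i => mem_filter.2 ⟨h.1.1 i, h.2 i⟩, h.1.2⟩
      _ = ∑ t ∈ A, (((powersetCard k (univ : Finset X)).filter fun S =>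
          ∀ i, bPred E P S (t i) (a S) (b (t i))).card : ℝ) := by
          exact_mod_cast sum_card_bipartiteAbove_eq_sum_card_bipartiteBelow
            (fun (S : Finset X) (t : Fin q → Finset Y) => ∀ i, bPred E P S (t i) (a S) (b (t i)))
      _ ≤ ∑ t ∈ A, K * Real.exp (-θ) := sum_le_sum fun t ht =>
          card_winning_sets_le E hE P ε hval a b k q t (mem_filter.1 ht).2
      _ = A.card * (K * Real.exp (-θ)) := by rw [sum_const, nsmul_eq_mul]
      _ ≤ _ := mul_le_mul_of_nonneg_right hAc (by positivity)
  clear_value θ r K L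
  have h1 : r * K * ((r * L) ^ q / 2) ≤ L ^ q * (K * Real.exp (-θ)) :=
    (mul_le_mul_of_nonneg_right hGc (by positivity)).trans hcount
  have h2 : r ^ (q + 1) / 2 ≤ Real.exp (-θ) := by
    refine le_of_mul_le_mul_left ?_ (show 0 < L ^ q * K by positivity)
    calc L ^ q * K * (r ^ (q + 1) / 2) = r * K * ((r * L) ^ q / 2) := by
          rw [mul_pow, pow_succ]; ring
      _ ≤ L ^ q * (K * Real.exp (-θ)) := h1
      _ = _ := by ring
  refine le_trans ?_ h2
  have h3 : 0 < r ^ (q + 1) := by positivity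
  rw [pow_succ r (q + 1)]
  nlinarith

lemma rounds_mul_le {ε k l e d n m : ℝ} {q : ℕ} (hε : 0 < ε) (hε1 : ε ≤ 1) (hk : 0 ≤ k)
    (hl : 0 < l) (hlm : l ≤ m) (he : 0 ≤ e) (hd : 0 < d) (hn : 0 < n)
    (hq : (q : ℝ) < 32 * m / (l * ε) + 1) :
    ((q : ℝ) + 2) * (1 / 128 * ε ^ 2 * (k * l * e / (d * n * m))) ≤
      k * (ε * e / (2 * d)) / n := by
  have hm : 0 < m := hl.trans_le hlm
  have h2 : 1 ≤ m / (l * ε) := by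
    rw [one_le_div (by positivity)]
    nlinarith
  have hq2 : (q : ℝ) + 2 ≤ 35 * (m / (l * ε)) := by
    have h3 : 32 * m / (l * ε) = 32 * (m / (l * ε)) := by ring
    linarith
  calc ((q : ℝ) + 2) * (1 / 128 * ε ^ 2 * (k * l * e / (d * n * m)))
      ≤ 35 * (m / (l * ε)) * (1 / 128 * ε ^ 2 * (k * l * e / (d * n * m))) :=
        mul_le_mul_of_nonneg_right hq2 (by positivity)
    _ = 35 / 64 * (k * (ε * e / (2 * d)) / n) := by field_simp; ring
    _ ≤ k * (ε * e / (2 * d)) / n := by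
        have : 0 ≤ k * (ε * e / (2 * d)) / n := by positivity
        linarith

/-- Birthday repetition with exponential decay and without dependence on the alphabets. -/
theorem birthdayVal_le_two_mul_exp {X Y AX AY : Type*} [Fintype X] [Fintype Y] [Fintype AX]
    [Fintype AY] [Nonempty AX] [Nonempty AY] (E : Finset (X × Y)) (hE : E.Nonempty)
    (P : X → Y → AX → AY → Prop) (ε : ℝ) (hε : 0 < ε) (hε1 : ε ≤ 1)
    (hval : gameVal (unifOn E) P = 1 - ε) (k l : ℕ) (hl0 : 0 < l)
    (hk : k ≤ Fintype.card X) (hl : l ≤ Fintype.card Y) :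
    birthdayVal E P k l ≤ 2 * Real.exp (-(1 / 128 * ε ^ 2 *
      ((k : ℝ) * l * E.card / (maxDeg E * Fintype.card X * Fintype.card Y)))) := by
  by_contra! hcon
  have hEc : (0 : ℝ) < E.card := by exact_mod_cast hE.card_pos
  have hdn : (0 : ℝ) < maxDeg E * Fintype.card X :=
    hEc.trans_le (by exact_mod_cast card_le_maxDeg_mul_card E)
  have hd : (0 : ℝ) < maxDeg E := pos_of_mul_pos_left hdn (by positivity)
  have hn : (0 : ℝ) < Fintype.card X := pos_of_mul_pos_right hdn (by positivity)
  have hl' : (0 : ℝ) < l := by exact_mod_cast hl0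
  have hlm : (l : ℝ) ≤ Fintype.card Y := by exact_mod_cast hl
  have hm : (0 : ℝ) < Fintype.card Y := hl'.trans_le hlm
  have hcon' := (lt_div_iff₀' (two_pos : (0 : ℝ) < 2)).2 hcon
  have hq : 8 / ε ≤ ⌈32 * (Fintype.card Y : ℝ) / (l * ε)⌉₊ * (l / Fintype.card Y : ℝ) / 4 := by
    calc 8 / ε = 32 * (Fintype.card Y : ℝ) / (l * ε) * ((l : ℝ) / Fintype.card Y) / 4 := by
          field_simp
          norm_num
      _ ≤ _ := by
          gcongr
          exact Nat.le_ceil _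
  have hpow := half_birthdayVal_pow_le E hE hd hn P ε hε hε1 hval k l hl0 hk hl hcon' _ hq
  have hlt := (pow_lt_pow_left₀ hcon' (Real.exp_pos _).le (Nat.succ_ne_zero _)).trans_le hpow
  rw [← Real.exp_nat_mul, Real.exp_lt_exp, mul_neg, neg_lt_neg_iff] at hlt
  have hle := rounds_mul_le (k := k) hε hε1 (by positivity) hl' hlm hEc.le hd hn
    (Nat.ceil_lt_add_one (by positivity))
  push_cast at hlt
  linarith

universe u₁ u₂ u₃ u₄

/-- **Birthday repetition theorem (general games).**  There is a universal constant `α > 0`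
such that for any two-prover game `G` whose question distribution is uniform over
`E ⊆ X × Y`, with maximum degree `d_max`, alphabets `AX`, `AY`, `c = log(|AX|·|AY|)` and
`val(G) = 1 − ε`, for all `0 ≤ k ≤ |X|`, `0 ≤ l ≤ |Y|`,
`val(G^{k×l}) ≤ 2·(1 − ε/2)^{α·ε⁵·k·l·|E| / (d_max·|X|·|Y|·c²)}`. -/
theorem birthday_repetition_theorem_general :
    ∃ α : ℝ, 0 < α ∧
      ∀ (X : Type u₁) (Y : Type u₂) (AX : Type u₃) (AY : Type u₄)
        [Fintype X] [Fintype Y] [Fintype AX] [Fintype AY] [Nonempty AX] [Nonempty AY]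
        (E : Finset (X × Y)) (P : X → Y → AX → AY → Prop) (ε : ℝ),
        E.Nonempty →
        gameVal (unifOn E) P = 1 - ε →
        ∀ k l : ℕ, k ≤ Fintype.card X → l ≤ Fintype.card Y →
          birthdayVal E P k l ≤
            2 * (1 - ε / 2) ^
              (α * ε ^ 5 * (k : ℝ) * (l : ℝ) * (E.card : ℝ) /
                ((maxDeg E : ℝ) * (Fintype.card X : ℝ) * (Fintype.card Y : ℝ) *
                  Real.log ((Fintype.card AX : ℝ) * (Fintype.card AY : ℝ)) ^ 2)) := by
  refine ⟨1 / 512, by norm_num, ?_⟩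
  intro X Y AX AY _ _ _ _ _ _ E P ε hE hval k l hk hl
  have hε0 : 0 ≤ ε := by linarith [gameVal_unifOn_le_one E P]
  have hEc : (0 : ℝ) < E.card := by exact_mod_cast hE.card_pos
  have hε1 : ε ≤ 1 := by
    have h := card_satisfied_le E hE P (fun _ => Classical.arbitrary AX)
      (fun _ => Classical.arbitrary AY)
    rw [hval] at h
    have h0 : 0 ≤ (1 - ε) * E.card := le_trans (by positivity) h
    linarith [nonneg_of_mul_nonneg_left h0 hEc]
  have hone := birthdayVal_le_one E P k l
  rcases hε0.eq_or_lt with hε | hε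
  · rw [← hε]
    simp only [zero_div, sub_zero, Real.one_rpow]
    linarith
  rcases Nat.eq_zero_or_pos l with hl0 | hl0
  · subst hl0
    simp only [Nat.cast_zero, mul_zero, zero_mul, zero_div, Real.rpow_zero]
    linarith
  set c : ℝ := Real.log ((Fintype.card AX : ℝ) * (Fintype.card AY : ℝ)) with hc
  rcases eq_or_ne c 0 with hc0 | hc0
  · rw [hc0]
    simp only [ne_eq, OfNat.ofNat_ne_zero, not_false_eq_true, zero_pow, mul_zero, div_zero,
      Real.rpow_zero]
    linarith
  have hc2 : 1 / 4 ≤ c ^ 2 := by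
    have h1 : 0 < Fintype.card AX * Fintype.card AY :=
      Nat.mul_pos Fintype.card_pos Fintype.card_pos
    have h2 : Fintype.card AX * Fintype.card AY ≠ 1 := by
      intro h
      refine hc0 ?_
      rw [hc, ← Nat.cast_mul, h, Nat.cast_one, Real.log_one]
    have h3 : (2 : ℝ) ≤ (Fintype.card AX : ℝ) * Fintype.card AY := by
      exact_mod_cast (by omega : 2 ≤ Fintype.card AX * Fintype.card AY)
    have h4 : Real.log 2 ≤ c := Real.log_le_log (by norm_num) h3
    have h5 := Real.log_two_gt_d9
    nlinarith
  refine (birthdayVal_le_two_mul_exp E hE P ε hε hε1 hval k l hl0 hk hl).trans ?_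
  set Z : ℝ := (k : ℝ) * l * E.card / (maxDeg E * Fintype.card X * Fintype.card Y) with hZ
  have hZ0 : 0 ≤ Z := by positivity
  have hx : 1 / 512 * ε ^ 5 * (k : ℝ) * (l : ℝ) * (E.card : ℝ) /
      ((maxDeg E : ℝ) * (Fintype.card X : ℝ) * (Fintype.card Y : ℝ) * c ^ 2) =
      1 / 512 * ε ^ 5 * Z / c ^ 2 := by
    rw [hZ, ← div_div]
    ring
  have hbase : 0 < 1 - ε / 2 := by linarith
  have hlog : -ε ≤ Real.log (1 - ε / 2) := by
    refine le_trans ?_ (Real.one_sub_inv_le_log_of_pos hbase)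
    have h1 : (1 - ε / 2)⁻¹ ≤ 1 + ε := by
      rw [inv_le_iff_one_le_mul₀ hbase]
      nlinarith
    linarith
  rw [hx, Real.rpow_def_of_pos hbase]
  refine mul_le_mul_of_nonneg_left (Real.exp_le_exp.2 ?_) (by norm_num)
  have hx1 : 1 / 512 * ε ^ 5 * Z / c ^ 2 ≤ 1 / 128 * ε ^ 5 * Z := by
    rw [div_le_iff₀ (by linarith)]
    have : 0 ≤ ε ^ 5 * Z := by positivity
    nlinarith
  have hx0 : 0 ≤ 1 / 512 * ε ^ 5 * Z / c ^ 2 := by positivity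
  calc -(1 / 128 * ε ^ 2 * Z) ≤ -(1 / 128 * ε ^ 6 * Z) := by
        have h1 : ε ^ 6 ≤ ε ^ 2 := pow_le_pow_of_le_one hε0 hε1 (by norm_num)
        have h2 : ε ^ 6 * Z ≤ ε ^ 2 * Z := mul_le_mul_of_nonneg_right h1 hZ0
        linarith
    _ = -ε * (1 / 128 * ε ^ 5 * Z) := by ring
    _ ≤ -ε * (1 / 512 * ε ^ 5 * Z / c ^ 2) := by nlinarith
    _ ≤ _ := mul_le_mul_of_nonneg_right hlog hx0
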